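/- Let Λ be the logistic measure on ℝ with density f(x) = e^x/(1+e^x)², and let Λ^N be its N-fold product measure on ℝ^N. Then for every N ≥ 1 and every t ∈ [0,1], the isoperimetric function satisfies I_{Λ^N}(t) ≥ (c₀/2) · t(1−t) = (c₀/2) · I_Λ(t), where c₀ = sup_{u ≥ 0} (1 − e^{−2u})/(2√u). -/

import Mathlib

open MeasureTheory Real
open scoped ENNReal

/-- The logistic density `f(x) = eˣ/(1+eˣ)²`. -/
noncomputable def logisticDensity (x : ℝ) : ℝ := Real.exp x / (1 + Real.exp x) ^ 2

/-- The `N`-fold product `Λ^N` of the logistic measure on `ℝ^N`. -/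
noncomputable def logisticProd (N : ℕ) : Measure (EuclideanSpace ℝ (Fin N)) :=
  volume.withDensity fun x => ENNReal.ofReal (∏ i, logisticDensity (x i))

/-- The boundary measure (Minkowski content) of a set `A`:
`τ⁺(∂A) = lim_{h→0⁺} (τ(A_h) - τ(A))/h` where `A_h = {x : dist(x,A) ≤ h}`. -/
noncomputable def boundaryMeasure {E : Type*} [MeasurableSpace E] [PseudoEMetricSpace E]
    (τ : Measure E) (A : Set E) : ℝ≥0∞ :=
  Filter.liminf (fun h : ℝ => (τ (Metric.cthickening h A) - τ A) / ENNReal.ofReal h)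
    (nhdsWithin 0 (Set.Ioi 0))

/-- The isoperimetric function `I_τ(y) = inf { τ⁺(∂A) : A Borel, τ(A) = y }`. -/
noncomputable def isopFun {E : Type*} [MeasurableSpace E] [PseudoEMetricSpace E]
    (τ : Measure E) (y : ℝ) : ℝ≥0∞ :=
  sInf {b | ∃ A : Set E, MeasurableSet A ∧ (τ A).toReal = y ∧ b = boundaryMeasure τ A}

/-- The constant `c₀ = sup_{u ≥ 0} (1 - e^{-2u})/(2√u)`. -/
noncomputable def isoC : ℝ :=
  sSup ((fun u : ℝ => (1 - Real.exp (-2 * u)) / (2 * Real.sqrt u)) '' Set.Ici 0)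


/-- The logistic measure `Λ` on the line. -/
noncomputable def logisticMeasure : Measure ℝ :=
  volume.withDensity fun x => ENNReal.ofReal (logisticDensity x)

/-- The distribution function `eˣ/(1+eˣ)` of the logistic measure. -/
noncomputable def logisticCDF (x : ℝ) : ℝ := Real.exp x / (1 + Real.exp x)

lemma logisticDensity_nonneg (x : ℝ) : 0 ≤ logisticDensity x := by
  unfold logisticDensity; positivity

lemma continuous_logisticDensity : Continuous logisticDensity := by
  unfold logisticDensity
  exact Real.continuous_exp.div (by fun_prop) fun x => by positivity

lemma hasDerivAt_logisticCDF (x : ℝ) : HasDerivAt logisticCDF (logisticDensity x) x := by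
  have h := (Real.hasDerivAt_exp x).div ((Real.hasDerivAt_exp x).const_add 1)
    (by positivity : 1 + Real.exp x ≠ 0)
  refine h.congr_deriv ?_
  unfold logisticDensity
  ring

lemma logisticCDF_eq (x : ℝ) : logisticCDF x = 1 - (1 + Real.exp x)⁻¹ := by
  unfold logisticCDF
  have : 1 + Real.exp x ≠ 0 := by positivity
  field_simp
  ring

lemma tendsto_logisticCDF_atTop : Filter.Tendsto logisticCDF Filter.atTop (nhds 1) := by
  have h : Filter.Tendsto (fun x => 1 - (1 + Real.exp x)⁻¹) Filter.atTop (nhds (1 - 0)) :=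
    tendsto_const_nhds.sub
      (Filter.tendsto_atTop_add_const_left _ 1 Real.tendsto_exp_atTop).inv_tendsto_atTop
  simpa [← logisticCDF_eq] using h

lemma tendsto_logisticCDF_atBot : Filter.Tendsto logisticCDF Filter.atBot (nhds 0) := by
  have h : Filter.Tendsto logisticCDF Filter.atBot (nhds (0 / (1 + 0))) :=
    Real.tendsto_exp_atBot.div (tendsto_const_nhds.add Real.tendsto_exp_atBot) (by norm_num)
  simpa using h

lemma integrable_logisticDensity : Integrable logisticDensity := by
  rw [← integrableOn_univ, ← Set.Iic_union_Ioi (a := (0 : ℝ))]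
  refine IntegrableOn.union ?_ (integrableOn_Ioi_deriv_of_nonneg'
    (fun x _ => hasDerivAt_logisticCDF x) (fun x _ => logisticDensity_nonneg x)
    tendsto_logisticCDF_atTop)
  refine (integrableOn_exp_Iic 0).mono' continuous_logisticDensity.aestronglyMeasurable ?_
  refine ae_of_all _ fun x => ?_
  rw [Real.norm_of_nonneg (logisticDensity_nonneg x)]
  refine div_le_self (Real.exp_pos x).le ?_
  nlinarith [Real.exp_pos x]

lemma integral_logisticDensity : ∫ x, logisticDensity x = 1 := by
  simpa using integral_of_hasDerivAt_of_tendsto hasDerivAt_logisticCDF integrable_logisticDensity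
    tendsto_logisticCDF_atBot tendsto_logisticCDF_atTop

instance : IsProbabilityMeasure logisticMeasure where
  measure_univ := by
    rw [logisticMeasure, withDensity_apply _ MeasurableSet.univ, setLIntegral_univ,
      ← ofReal_integral_eq_lintegral_ofReal integrable_logisticDensity
        (ae_of_all _ logisticDensity_nonneg), integral_logisticDensity, ENNReal.ofReal_one]

lemma logisticMeasure_Iio (s : ℝ) :
    logisticMeasure (Set.Iio s) = ENNReal.ofReal (logisticCDF s) := by
  rw [logisticMeasure, withDensity_apply _ measurableSet_Iio,
    ← ofReal_integral_eq_lintegral_ofReal integrable_logisticDensity.integrableOn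
      (ae_of_all _ logisticDensity_nonneg), ← integral_Iic_eq_integral_Iio,
    integral_Iic_of_hasDerivAt_of_tendsto' (fun x _ => hasDerivAt_logisticCDF x)
      integrable_logisticDensity.integrableOn tendsto_logisticCDF_atBot, sub_zero]

lemma logisticMeasure_Ici (s : ℝ) :
    logisticMeasure (Set.Ici s) = ENNReal.ofReal (1 - logisticCDF s) := by
  rw [← Set.compl_Iio, prob_compl_eq_one_sub measurableSet_Iio, logisticMeasure_Iio,
    ENNReal.ofReal_sub _ (by unfold logisticCDF; positivity), ENNReal.ofReal_one]

lemma logisticMeasure_Iio_mul_Ici (s : ℝ) :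
    logisticMeasure (Set.Iio s) * logisticMeasure (Set.Ici s) =
      ENNReal.ofReal (logisticDensity s) := by
  rw [logisticMeasure_Iio, logisticMeasure_Ici,
    ← ENNReal.ofReal_mul (by unfold logisticCDF; positivity)]
  congr 1
  unfold logisticCDF logisticDensity
  have : 1 + Real.exp s ≠ 0 := by positivity
  field_simp
  ring

/-- Cheeger-type identity for the logistic measure, in Fubini form. -/
lemma lintegral_lintegral_uIoc_le {w : ℝ → ℝ≥0∞} (hw : Measurable w) :
    ∫⁻ x, ∫⁻ y, (∫⁻ s in Set.uIoc x y, w s) ∂logisticMeasure ∂logisticMeasure ≤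
      2 * ∫⁻ s, w s ∂logisticMeasure := by
  set a : ℝ → ℝ → ℝ≥0∞ := fun x s => (Set.Iio s).indicator 1 x with ha
  set b : ℝ → ℝ → ℝ≥0∞ := fun x s => (Set.Ici s).indicator 1 x with hb
  have ham : Measurable (Function.uncurry a) := by
    have : Function.uncurry a = {p : ℝ × ℝ | p.1 < p.2}.indicator 1 := by
      ext p; simp [ha, Set.indicator, Function.uncurry]
    rw [this]
    exact measurable_one.indicator (measurableSet_lt measurable_fst measurable_snd)
  have hbm : Measurable (Function.uncurry b) := by
    have : Function.uncurry b = {p : ℝ × ℝ | p.2 ≤ p.1}.indicator 1 := by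
      ext p; simp [hb, Set.indicator, Function.uncurry]
    rw [this]
    exact measurable_one.indicator (measurableSet_le measurable_snd measurable_fst)
  have am : ∀ {α : Type} [MeasurableSpace α] {f g : α → ℝ}, Measurable f → Measurable g →
      Measurable fun z => a (f z) (g z) := fun hf hg => ham.comp (hf.prodMk hg)
  have bm : ∀ {α : Type} [MeasurableSpace α] {f g : α → ℝ}, Measurable f → Measurable g →
      Measurable fun z => b (f z) (g z) := fun hf hg => hbm.comp (hf.prodMk hg)
  have am' : ∀ s, Measurable fun x => a x s := fun s => am measurable_id measurable_const
  have bm' : ∀ s, Measurable fun x => b x s := fun s => bm measurable_id measurable_const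
  have hA : ∀ s, ∫⁻ x, a x s ∂logisticMeasure = logisticMeasure (Set.Iio s) := fun s =>
    lintegral_indicator_one measurableSet_Iio
  have hB : ∀ s, ∫⁻ x, b x s ∂logisticMeasure = logisticMeasure (Set.Ici s) := fun s =>
    lintegral_indicator_one measurableSet_Ici
  calc
    _ ≤ ∫⁻ x, ∫⁻ y, (∫⁻ s, (a x s * b y s + b x s * a y s) * w s)
          ∂logisticMeasure ∂logisticMeasure := by
      refine lintegral_mono fun x => lintegral_mono fun y => ?_
      rw [← lintegral_indicator measurableSet_uIoc]
      refine lintegral_mono fun s => ?_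
      by_cases hs : s ∈ Set.uIoc x y
      · rw [Set.indicator_of_mem hs]
        rcases Set.mem_uIoc.1 hs with h | h
        · have h1 : a x s = 1 := Set.indicator_of_mem (Set.mem_Iio.2 h.1) 1
          have h2 : b y s = 1 := Set.indicator_of_mem (Set.mem_Ici.2 h.2) 1
          rw [h1, h2, one_mul, add_mul, one_mul]
          exact le_self_add
        · have h1 : a y s = 1 := Set.indicator_of_mem (Set.mem_Iio.2 h.1) 1
          have h2 : b x s = 1 := Set.indicator_of_mem (Set.mem_Ici.2 h.2) 1
          rw [h1, h2, one_mul, add_mul, one_mul]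
          exact le_add_self
      · simp [Set.indicator_of_notMem hs]
    _ = ∫⁻ x, (∫⁻ s, ∫⁻ y, (a x s * b y s + b x s * a y s) * w s ∂logisticMeasure)
          ∂logisticMeasure := by
      refine lintegral_congr fun x => lintegral_lintegral_swap ?_
      refine Measurable.aemeasurable ?_
      unfold Function.uncurry
      exact ((((am measurable_const measurable_snd).mul (bm measurable_fst measurable_snd)).add
        ((bm measurable_const measurable_snd).mul (am measurable_fst measurable_snd)))).mul
        (hw.comp measurable_snd)
    _ = ∫⁻ x, (∫⁻ s, (a x s * logisticMeasure (Set.Ici s) +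
          b x s * logisticMeasure (Set.Iio s)) * w s) ∂logisticMeasure := by
      refine lintegral_congr fun x => lintegral_congr fun s => ?_
      rw [lintegral_mul_const _ (by exact ((bm' s).const_mul _).add ((am' s).const_mul _)),
        lintegral_add_left ((bm' s).const_mul _), lintegral_const_mul _ (bm' s),
        lintegral_const_mul _ (am' s), hA, hB]
    _ = ∫⁻ s, (∫⁻ x, (a x s * logisticMeasure (Set.Ici s) +
          b x s * logisticMeasure (Set.Iio s)) * w s ∂logisticMeasure) := by
      refine lintegral_lintegral_swap (Measurable.aemeasurable ?_)
      have h1 : Measurable fun s => logisticMeasure (Set.Ici s) := by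
        simp_rw [← hB]
        exact Measurable.lintegral_prod_left hbm
      have h2 : Measurable fun s => logisticMeasure (Set.Iio s) := by
        simp_rw [← hA]
        exact Measurable.lintegral_prod_left ham
      unfold Function.uncurry
      exact (((am measurable_fst measurable_snd).mul (h1.comp measurable_snd)).add
        ((bm measurable_fst measurable_snd).mul (h2.comp measurable_snd))).mul
        (hw.comp measurable_snd)
    _ = ∫⁻ s, ENNReal.ofReal (logisticDensity s) * (2 * w s) := by
      refine lintegral_congr fun s => ?_
      rw [lintegral_mul_const _ (by exact ((am' s).mul_const _).add ((bm' s).mul_const _)),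
        lintegral_add_left ((am' s).mul_const _), lintegral_mul_const _ (am' s),
        lintegral_mul_const _ (bm' s), hA, hB,
        ← logisticMeasure_Iio_mul_Ici]
      ring
    _ = 2 * ∫⁻ s, w s ∂logisticMeasure := by
      rw [← lintegral_const_mul _ hw, logisticMeasure,
        lintegral_withDensity_eq_lintegral_mul _
          (continuous_logisticDensity.measurable.ennreal_ofReal) (hw.const_mul 2)]
      rfl

/-- A primitive of `y ↦ min (2|y|) 1`. -/
noncomputable def truncSq (y : ℝ) : ℝ :=
  max y 0 ^ 2 - max (-y) 0 ^ 2 - max (y - 1 / 2) 0 ^ 2 + max (-y - 1 / 2) 0 ^ 2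

lemma hasDerivAt_max_zero_sq (y : ℝ) :
    HasDerivAt (fun x : ℝ => max x 0 ^ 2) (2 * max y 0) y := by
  rcases lt_trichotomy y 0 with h | h | h
  · rw [max_eq_right h.le, mul_zero]
    refine (hasDerivAt_const y (0 : ℝ)).congr_of_eventuallyEq ?_
    filter_upwards [Iio_mem_nhds h] with x hx
    simp [max_eq_right (le_of_lt (Set.mem_Iio.1 hx))]
  · subst h
    rw [hasDerivAt_iff_isLittleO_nhds_zero]
    simp only [zero_add, max_self, mul_zero, smul_zero, sub_zero, ne_eq, OfNat.ofNat_ne_zero,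
      not_false_eq_true, zero_pow]
    have h : (fun h : ℝ => max h 0 ^ 2) =O[nhds 0] fun h : ℝ => h ^ 2 := by
      refine Asymptotics.IsBigO.of_bound 1 (Filter.Eventually.of_forall fun x => ?_)
      rw [one_mul, Real.norm_of_nonneg (by positivity), Real.norm_of_nonneg (by positivity)]
      rcases le_total x 0 with hx | hx
      · simp [max_eq_right hx, sq_nonneg]
      · simp [max_eq_left hx]
    exact h.trans_isLittleO (Asymptotics.isLittleO_pow_id one_lt_two)
  · rw [max_eq_left h.le]
    have h2 := hasDerivAt_pow 2 y
    refine (h2.congr_deriv (by norm_num)).congr_of_eventuallyEq ?_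
    filter_upwards [Ioi_mem_nhds h] with x hx
    simp [max_eq_left (le_of_lt (Set.mem_Ioi.1 hx))]

lemma hasDerivAt_truncSq (y : ℝ) : HasDerivAt truncSq (min (2 * |y|) 1) y := by
  have h1 := hasDerivAt_max_zero_sq y
  have h2 := (hasDerivAt_max_zero_sq (-y)).comp y (hasDerivAt_neg y)
  have h3 := (hasDerivAt_max_zero_sq (y - 1 / 2)).comp y ((hasDerivAt_id y).sub_const (1 / 2))
  have h4 := (hasDerivAt_max_zero_sq (-y - 1 / 2)).comp y ((hasDerivAt_neg y).sub_const (1 / 2))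
  refine (((h1.sub h2).sub h3).add h4).congr_deriv ?_
  rcases le_total 0 y with h | h
  · rw [abs_of_nonneg h, max_eq_left h, max_eq_right (by linarith : -y ≤ 0),
      max_eq_right (by linarith : -y - 1 / 2 ≤ 0)]
    rcases le_total y (1 / 2) with h' | h'
    · rw [max_eq_right (by linarith : y - 1 / 2 ≤ 0), min_eq_left (by linarith)]; ring
    · rw [max_eq_left (by linarith : 0 ≤ y - 1 / 2), min_eq_right (by linarith)]; ring
  · rw [abs_of_nonpos h, max_eq_right h, max_eq_left (by linarith : 0 ≤ -y),
      max_eq_right (by linarith : y - 1 / 2 ≤ 0)]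
    rcases le_total (-y) (1 / 2) with h' | h'
    · rw [max_eq_right (by linarith : -y - 1 / 2 ≤ 0), min_eq_left (by linarith)]; ring
    · rw [max_eq_left (by linarith : 0 ≤ -y - 1 / 2), min_eq_right (by linarith)]; ring

lemma truncSq_cases (y : ℝ) :
    (y ≤ -1 / 2 ∧ truncSq y = y + 1 / 4) ∨ (-1 / 2 ≤ y ∧ y ≤ 0 ∧ truncSq y = -y ^ 2) ∨
      (0 ≤ y ∧ y ≤ 1 / 2 ∧ truncSq y = y ^ 2) ∨ (1 / 2 ≤ y ∧ truncSq y = y - 1 / 4) := by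
  unfold truncSq
  rcases le_total 0 y with h | h
  · rw [max_eq_left h, max_eq_right (by linarith : -y ≤ 0),
      max_eq_right (by linarith : -y - 1 / 2 ≤ 0)]
    rcases le_total y (1 / 2) with h' | h'
    · rw [max_eq_right (by linarith : y - 1 / 2 ≤ 0)]
      exact Or.inr (Or.inr (Or.inl ⟨h, h', by ring⟩))
    · rw [max_eq_left (by linarith : 0 ≤ y - 1 / 2)]
      exact Or.inr (Or.inr (Or.inr ⟨h', by ring⟩))
  · rw [max_eq_right h, max_eq_left (by linarith : 0 ≤ -y),
      max_eq_right (by linarith : y - 1 / 2 ≤ 0)]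
    rcases le_total (-y) (1 / 2) with h' | h'
    · rw [max_eq_right (by linarith : -y - 1 / 2 ≤ 0)]
      exact Or.inr (Or.inl ⟨by linarith, h, by ring⟩)
    · rw [max_eq_left (by linarith : 0 ≤ -y - 1 / 2)]
      exact Or.inl ⟨by linarith, by ring⟩

lemma sq_sub_le_truncSq_sub {a b : ℝ} (hba : b ≤ a) (hab : a - b ≤ 1) :
    (a - b) ^ 2 ≤ 2 * (truncSq a - truncSq b) := by
  rcases hba.eq_or_lt with rfl | hlt
  · simp
  rcases truncSq_cases a with ⟨h1, e⟩ | ⟨h1, h2, e⟩ | ⟨h1, h2, e⟩ | ⟨h1, e⟩ <;>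
  rcases truncSq_cases b with ⟨h3, e'⟩ | ⟨h3, h4, e'⟩ | ⟨h3, h4, e'⟩ | ⟨h3, e'⟩ <;>
  first
  | (exfalso; linarith)
  | (rw [e, e']
     first
     | nlinarith [mul_nonneg (sub_nonneg.2 hba) (sub_nonneg.2 hab)]
     | nlinarith [sq_nonneg (a + b)])

lemma quarter_mul_le_sqrt {s m D : ℝ} (hs : s ∈ Set.Icc (0 : ℝ) 1) :
    s * (1 - s) / 4 + min (2 * |s - m|) 1 * |D| - (s - m) ^ 2 / 4 ≤
      √((s * (1 - s) / 4) ^ 2 + D ^ 2) := by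
  obtain ⟨h0, h1⟩ := hs
  set q := min (2 * |s - m|) 1 with hq
  set J := s * (1 - s) / 4 with hJ
  have hq0 : 0 ≤ q := le_min (by positivity) zero_le_one
  have hq1 : q ≤ 1 := min_le_right _ _
  have hqm : q ^ 2 ≤ 4 * (s - m) ^ 2 := by
    have : q ^ 2 ≤ (2 * |s - m|) ^ 2 := pow_le_pow_left₀ hq0 (min_le_left _ _) 2
    rwa [mul_pow, sq_abs, show (2 : ℝ) ^ 2 = 4 by norm_num] at this
  have hJ0 : 0 ≤ J := by rw [hJ]; nlinarith
  have hJ1 : J ≤ 1 / 16 := by rw [hJ]; nlinarith [sq_nonneg (s - 1 / 2)]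
  have key : J * (1 - q ^ 2) + q * |D| ≤ √(J ^ 2 + D ^ 2) := by
    refine Real.le_sqrt_of_sq_le ?_
    rw [← sq_abs D]
    have h2 : (J * (1 - q ^ 2) + q * |D|) ^ 2 ≤
        (J ^ 2 + |D| ^ 2) * ((1 - q ^ 2) ^ 2 + q ^ 2) := by
      nlinarith [sq_nonneg (J * q - |D| * (1 - q ^ 2))]
    refine h2.trans (mul_le_of_le_one_right (by positivity) ?_)
    nlinarith [mul_nonneg (sq_nonneg q) (by nlinarith : 0 ≤ 1 - q ^ 2)]
  nlinarith [mul_nonneg hJ0 (sq_nonneg q), mul_nonneg (sub_nonneg.2 hJ1) (sq_nonneg q)]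

/-- Bobkov's functional inequality for the logistic measure on the line, with profile
`t ↦ t(1-t)/4`. -/
lemma logisticMeasure_functional_ineq {f : ℝ → ℝ} {K : ℝ} (hf : Differentiable ℝ f)
    (hK : ∀ x, |deriv f x| ≤ K) (h01 : ∀ x, f x ∈ Set.Icc (0 : ℝ) 1) :
    (∫ x, f x ∂logisticMeasure) * (1 - ∫ x, f x ∂logisticMeasure) / 4 ≤
      ∫ x, √((f x * (1 - f x) / 4) ^ 2 + deriv f x ^ 2) ∂logisticMeasure := by
  set m := ∫ x, f x ∂logisticMeasure with hm
  set V := ∫ x, f x ^ 2 ∂logisticMeasure with hV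
  set g' : ℝ → ℝ := fun x => min (2 * |f x - m|) 1 * deriv f x with hg'
  have hfm : Measurable f := hf.continuous.measurable
  have hdm : Measurable (deriv f) := measurable_deriv f
  have hg'm : Measurable g' := by
    exact (((hfm.sub_const m).abs.const_mul 2).min measurable_const).mul hdm
  have hg'K : ∀ x, |g' x| ≤ K := by
    intro x
    rw [hg', abs_mul]
    refine (mul_le_of_le_one_left (abs_nonneg _) ?_).trans (hK x)
    rw [abs_of_nonneg (le_min (by positivity) zero_le_one)]
    exact min_le_right _ _
  have hder : ∀ x, HasDerivAt (fun x => truncSq (f x - m)) (g' x) x := fun x =>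
    HasDerivAt.comp (h₂ := truncSq) (h := fun x => f x - m) x (hasDerivAt_truncSq (f x - m))
      ((hf x).hasDerivAt.sub_const m)
  have hfi : Integrable f logisticMeasure :=
    Integrable.of_bound hfm.aestronglyMeasurable 1 (ae_of_all _ fun x => by
      rw [Real.norm_of_nonneg (h01 x).1]; exact (h01 x).2)
  have hf2i : Integrable (fun x => f x ^ 2) logisticMeasure :=
    Integrable.of_bound (hfm.pow_const 2).aestronglyMeasurable 1 (ae_of_all _ fun x => by
      rw [Real.norm_of_nonneg (sq_nonneg _)]; exact pow_le_one₀ (h01 x).1 (h01 x).2)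
  have hg'i : Integrable (fun x => |g' x|) logisticMeasure :=
    Integrable.of_bound hg'm.abs.aestronglyMeasurable K (ae_of_all _ fun x => by
      rw [Real.norm_eq_abs, abs_abs]; exact hg'K x)
  have hosc : ∀ x y, ENNReal.ofReal ((f x - f y) ^ 2) ≤
      2 * ∫⁻ s in Set.uIoc x y, ENNReal.ofReal |g' s| := by
    intro x y
    have h1 : (f x - f y) ^ 2 ≤ 2 * |truncSq (f y - m) - truncSq (f x - m)| := by
      rcases le_total (f x) (f y) with h | h
      · have := sq_sub_le_truncSq_sub (sub_le_sub_right h m)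
          (by linarith [(h01 x).1, (h01 y).2])
        nlinarith [le_abs_self (truncSq (f y - m) - truncSq (f x - m))]
      · have := sq_sub_le_truncSq_sub (sub_le_sub_right h m)
          (by linarith [(h01 y).1, (h01 x).2])
        nlinarith [neg_le_abs (truncSq (f y - m) - truncSq (f x - m))]
    have hgi : IntervalIntegrable g' volume x y :=
      (intervalIntegrable_const (c := K)).mono_fun' hg'm.aestronglyMeasurable
        (ae_of_all _ fun s => hg'K s)
    rw [← intervalIntegral.integral_eq_sub_of_hasDerivAt (fun s _ => hder s) hgi,
      ← Real.norm_eq_abs, intervalIntegral.norm_intervalIntegral_eq] at h1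
    refine (ENNReal.ofReal_le_ofReal h1).trans ?_
    rw [ENNReal.ofReal_mul zero_le_two, ENNReal.ofReal_ofNat, ofReal_norm]
    gcongr
    refine (enorm_integral_le_lintegral_enorm _).trans_eq (lintegral_congr fun s => ?_)
    rw [Real.enorm_eq_ofReal_abs]
  have hinner : ∀ x, ∫⁻ y, ENNReal.ofReal ((f x - f y) ^ 2) ∂logisticMeasure =
      ENNReal.ofReal (f x ^ 2 - 2 * f x * m + V) := by
    intro x
    have e : ∀ y, (f x - f y) ^ 2 = f x ^ 2 - 2 * f x * f y + f y ^ 2 := fun y => by ring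
    have hi : Integrable (fun y => f x ^ 2 - 2 * f x * f y) logisticMeasure :=
      (integrable_const _).sub (hfi.const_mul _)
    rw [← ofReal_integral_eq_lintegral_ofReal ?_ (ae_of_all _ fun y => sq_nonneg _)]
    · simp_rw [e]
      rw [integral_add hi hf2i, integral_sub (integrable_const _) (hfi.const_mul _),
        integral_const_mul]
      simp [hm, hV]
    · simp_rw [e]
      exact hi.add hf2i
  have hVar : 2 * (V - m ^ 2) ≤ 4 * ∫ x, |g' x| ∂logisticMeasure := by
    have h1 : ∫⁻ x, ENNReal.ofReal (f x ^ 2 - 2 * f x * m + V) ∂logisticMeasure ≤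
        2 * (2 * ∫⁻ s, ENNReal.ofReal |g' s| ∂logisticMeasure) := by
      simp_rw [← hinner]
      calc _ ≤ ∫⁻ x, ∫⁻ y, (2 * ∫⁻ s in Set.uIoc x y, ENNReal.ofReal |g' s|)
              ∂logisticMeasure ∂logisticMeasure :=
            lintegral_mono fun x => lintegral_mono fun y => hosc x y
        _ = 2 * ∫⁻ x, ∫⁻ y, (∫⁻ s in Set.uIoc x y, ENNReal.ofReal |g' s|)
              ∂logisticMeasure ∂logisticMeasure := by
            simp_rw [lintegral_const_mul' 2 _ ENNReal.ofNat_ne_top]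
        _ ≤ _ := by
            gcongr
            exact lintegral_lintegral_uIoc_le hg'm.abs.ennreal_ofReal
    have hi : Integrable (fun x => f x ^ 2 - 2 * f x * m) logisticMeasure :=
      hf2i.sub ((hfi.const_mul 2).mul_const m)
    have hnn : ∀ x, 0 ≤ f x ^ 2 - 2 * f x * m + V := by
      intro x
      have : m ^ 2 ≤ V := by
        have h := integral_nonneg (μ := logisticMeasure) (f := fun x => (f x - m) ^ 2)
          (fun x => sq_nonneg _)
        have e : ∀ y, (f y - m) ^ 2 = f y ^ 2 - 2 * f y * m + m ^ 2 := fun y => by ring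
        simp_rw [e] at h
        rw [integral_add hi (integrable_const _),
          integral_sub hf2i ((hfi.const_mul 2).mul_const m), integral_mul_const,
          integral_const_mul] at h
        simp only [integral_const, probReal_univ, one_smul, ← hm, ← hV] at h
        nlinarith
      nlinarith [sq_nonneg (f x - m)]
    rw [← ofReal_integral_eq_lintegral_ofReal hg'i (ae_of_all _ fun x => abs_nonneg _),
      ← ofReal_integral_eq_lintegral_ofReal (by exact hi.add (integrable_const _))
        (ae_of_all _ hnn),
      ← ENNReal.ofReal_ofNat, ← ENNReal.ofReal_mul zero_le_two, ← ENNReal.ofReal_mul zero_le_two,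
      ENNReal.ofReal_le_ofReal_iff (by positivity)] at h1
    have e : ∫ x, (f x ^ 2 - 2 * f x * m + V) ∂logisticMeasure = 2 * (V - m ^ 2) := by
      rw [integral_add hi (integrable_const _),
        integral_sub hf2i ((hfi.const_mul 2).mul_const m), integral_mul_const,
        integral_const_mul]
      simp only [integral_const, probReal_univ, one_smul, ← hm, ← hV]
      ring
    have h1' := e.symm.trans_le h1
    linarith
  have hlow : ∫ x, (f x / 4 + m / 2 * f x - f x ^ 2 / 2 - m ^ 2 / 4 + |g' x|) ∂logisticMeasure ≤
      ∫ x, √((f x * (1 - f x) / 4) ^ 2 + deriv f x ^ 2) ∂logisticMeasure := by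
    refine integral_mono ?_ ?_ fun x => ?_
    · exact ((((hfi.div_const 4).add (hfi.const_mul _)).sub (hf2i.div_const 2)).sub
        (integrable_const _)).add hg'i
    · refine Integrable.of_bound (Measurable.aestronglyMeasurable (by fun_prop)) (1 + K)
        (ae_of_all _ fun x => ?_)
      rw [Real.norm_of_nonneg (Real.sqrt_nonneg _)]
      have hK0 := (abs_nonneg _).trans (hK x)
      refine Real.sqrt_le_iff.2 ⟨by positivity, ?_⟩
      have h1 : deriv f x ^ 2 ≤ K ^ 2 := sq_le_sq' (by linarith [neg_le_of_abs_le (hK x)])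
        (le_of_abs_le (hK x))
      have h2 : (f x * (1 - f x) / 4) ^ 2 ≤ 1 := by
        have := h01 x
        refine pow_le_one₀ ?_ ?_ <;> nlinarith [this.1, this.2]
      nlinarith
    · refine le_trans (le_of_eq ?_) (quarter_mul_le_sqrt (m := m) (h01 x))
      have : |g' x| = min (2 * |f x - m|) 1 * |deriv f x| := by
        rw [hg', abs_mul, abs_of_nonneg (le_min (by positivity) zero_le_one)]
      simp only [this]
      ring
  refine le_trans ?_ hlow
  have i1 : Integrable (fun x => f x / 4 + m / 2 * f x) logisticMeasure :=
    (hfi.div_const 4).add (hfi.const_mul _)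
  have i2 : Integrable (fun x => f x / 4 + m / 2 * f x - f x ^ 2 / 2) logisticMeasure :=
    i1.sub (hf2i.div_const 2)
  have i3 : Integrable (fun x => f x / 4 + m / 2 * f x - f x ^ 2 / 2 - m ^ 2 / 4)
      logisticMeasure := i2.sub (integrable_const _)
  rw [integral_add i3 hg'i, integral_sub i2 (integrable_const _),
    integral_sub i1 (hf2i.div_const 2), integral_add (hfi.div_const 4) (hfi.const_mul _),
    integral_div, integral_div, integral_const_mul]
  simp only [integral_const, probReal_univ, one_smul, ← hm, ← hV]
  nlinarith

/-- The integrand of Bobkov's functional inequality with profile `t ↦ t(1-t)/4`. -/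
noncomputable def bobkovIntegrand {n : ℕ} (f : (Fin n → ℝ) → ℝ) (x : Fin n → ℝ) : ℝ :=
  √((f x * (1 - f x) / 4) ^ 2 + ∑ i, fderiv ℝ f x (Pi.single i 1) ^ 2)

lemma bobkovIntegrand_nonneg {n : ℕ} (f : (Fin n → ℝ) → ℝ) (x : Fin n → ℝ) :
    0 ≤ bobkovIntegrand f x := Real.sqrt_nonneg _

lemma measurable_bobkovIntegrand {n : ℕ} {f : (Fin n → ℝ) → ℝ} (hf : Differentiable ℝ f) :
    Measurable (bobkovIntegrand f) := by
  have hfm : Measurable f := hf.continuous.measurable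
  have hd : ∀ i, Measurable fun x => fderiv ℝ f x (Pi.single i (1 : ℝ)) := fun i =>
    measurable_fderiv_apply_const ℝ f _
  unfold bobkovIntegrand
  fun_prop

lemma integrable_bobkovIntegrand {n : ℕ} {f : (Fin n → ℝ) → ℝ} {K : ℝ}
    (hf : Differentiable ℝ f) (hK : ∀ x, ‖fderiv ℝ f x‖ ≤ K)
    (h01 : ∀ x, f x ∈ Set.Icc (0 : ℝ) 1) (μ : Measure (Fin n → ℝ)) [IsFiniteMeasure μ] :
    Integrable (bobkovIntegrand f) μ := by
  refine Integrable.of_bound (measurable_bobkovIntegrand hf).aestronglyMeasurable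
    (√(1 + ∑ i, (K * ‖(Pi.single i 1 : Fin n → ℝ)‖) ^ 2)) (ae_of_all _ fun x => ?_)
  rw [Real.norm_of_nonneg (bobkovIntegrand_nonneg f x)]
  refine Real.sqrt_le_sqrt (add_le_add ?_ (Finset.sum_le_sum fun i _ => ?_))
  · have := h01 x
    refine pow_le_one₀ ?_ ?_ <;> nlinarith [this.1, this.2]
  · rw [← sq_abs (fderiv ℝ f x _), ← Real.norm_eq_abs]
    refine pow_le_pow_left₀ (norm_nonneg _) ?_ 2
    exact (ContinuousLinearMap.le_opNorm _ _).trans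
      (mul_le_mul_of_nonneg_right (hK x) (norm_nonneg _))

lemma sqrt_sum_sq_integral_le {Ω ι : Type*} [MeasurableSpace Ω] [Fintype ι] {μ : Measure Ω}
    {g : ι → Ω → ℝ} (hg : ∀ i, Integrable (g i) μ) :
    √(∑ i, (∫ x, g i x ∂μ) ^ 2) ≤ ∫ x, √(∑ i, g i x ^ 2) ∂μ := by
  have h := norm_integral_le_integral_norm (μ := μ) fun x => WithLp.toLp 2 fun i => g i x
  simp only [EuclideanSpace.norm_eq, Real.norm_eq_abs, sq_abs] at h
  convert h using 5 with i
  rw [eval_integral_piLp hg]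

/-- The inclusion of the last `n` coordinates. -/
noncomputable def consZeroCLM (n : ℕ) : (Fin n → ℝ) →L[ℝ] (Fin (n + 1) → ℝ) :=
  ContinuousLinearMap.pi (Fin.cons 0 fun i => ContinuousLinearMap.proj i)

lemma consZeroCLM_single {n : ℕ} (i : Fin n) :
    consZeroCLM n (Pi.single i 1) = Pi.single i.succ 1 := by
  ext j
  refine Fin.cases ?_ (fun j => ?_) j
  · simp [consZeroCLM, (Fin.succ_ne_zero i).symm]
  · simp [consZeroCLM, Pi.single_apply]

lemma hasFDerivAt_cons_right {n : ℕ} (x : ℝ) (y : Fin n → ℝ) :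
    HasFDerivAt (fun y : Fin n → ℝ => (Fin.cons x y : Fin (n + 1) → ℝ)) (consZeroCLM n) y := by
  refine hasFDerivAt_pi.2 fun j => ?_
  refine Fin.cases ?_ (fun j => ?_) j
  · simpa using hasFDerivAt_const x y
  · simpa using hasFDerivAt_apply j y

lemma hasDerivAt_cons_left {n : ℕ} (x : ℝ) (y : Fin n → ℝ) :
    HasDerivAt (fun x : ℝ => (Fin.cons x y : Fin (n + 1) → ℝ)) (Pi.single 0 1) x := by
  refine hasDerivAt_pi.2 fun j => ?_
  refine Fin.cases ?_ (fun j => ?_) j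
  · simpa using hasDerivAt_id' x
  · simpa using hasDerivAt_const x (y j)

lemma measurable_cons_uncurry (n : ℕ) :
    Measurable fun p : ℝ × (Fin n → ℝ) => (Fin.cons p.1 p.2 : Fin (n + 1) → ℝ) := by
  refine measurable_pi_iff.2 fun j => ?_
  refine Fin.cases ?_ (fun j => ?_) j
  · simpa using measurable_fst
  · simp only [Fin.cons_succ]
    fun_prop

lemma measurePreserving_cons (n : ℕ) (μ : Measure ℝ) [SigmaFinite μ] :
    MeasurePreserving (fun p : ℝ × (Fin n → ℝ) => (Fin.cons p.1 p.2 : Fin (n + 1) → ℝ))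
      (μ.prod (Measure.pi fun _ => μ)) (Measure.pi fun _ => μ) := by
  have h := (measurePreserving_piFinSuccAbove (fun _ : Fin (n + 1) => μ) 0).symm
  convert h using 2 with p
  simp [MeasurableEquiv.piFinSuccAbove]
  rfl

/-- Tensorization: Bobkov's functional inequality for the product of logistic measures. -/
lemma pi_logisticMeasure_functional_ineq (n : ℕ) {f : (Fin n → ℝ) → ℝ} {K : ℝ}
    (hf : Differentiable ℝ f) (hK : ∀ x, ‖fderiv ℝ f x‖ ≤ K)
    (h01 : ∀ x, f x ∈ Set.Icc (0 : ℝ) 1) :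
    (∫ x, f x ∂Measure.pi fun _ => logisticMeasure) *
        (1 - ∫ x, f x ∂Measure.pi fun _ => logisticMeasure) / 4 ≤
      ∫ x, bobkovIntegrand f x ∂Measure.pi fun _ => logisticMeasure := by
  induction n generalizing K with
  | zero =>
    rw [Measure.pi_of_empty (fun _ : Fin 0 => logisticMeasure) 0, integral_dirac, integral_dirac]
    refine Real.le_sqrt_of_sq_le ?_
    simp
  | succ n ih =>
    set ν : Measure (Fin n → ℝ) := Measure.pi fun _ => logisticMeasure with hν
    set c : ℝ → (Fin n → ℝ) → (Fin (n + 1) → ℝ) := fun x y => Fin.cons x y with hc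
    have hcm : Measurable fun p : ℝ × (Fin n → ℝ) => c p.1 p.2 := measurable_cons_uncurry n
    have hcx : ∀ y, Measurable fun x => c x y := fun y =>
      hcm.comp (measurable_id.prodMk measurable_const)
    have hfm : Measurable f := hf.continuous.measurable
    have hfi : ∀ (y : Fin n → ℝ), Integrable (fun x => f (c x y)) logisticMeasure := fun y =>
      Integrable.of_bound (hfm.comp (hcx y)).aestronglyMeasurable 1 (ae_of_all _ fun x => by
        rw [Real.norm_of_nonneg (h01 _).1]; exact (h01 _).2)
    set F : (Fin n → ℝ) → ℝ := fun y => ∫ x, f (c x y) ∂logisticMeasure with hF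
    have hDbound : ∀ x y, ‖(fderiv ℝ f (c x y)).comp (consZeroCLM n)‖ ≤ K * ‖consZeroCLM n‖ :=
      fun x y => (ContinuousLinearMap.opNorm_comp_le _ _).trans
        (mul_le_mul_of_nonneg_right (hK _) (norm_nonneg _))
    have hDm : ∀ y, AEStronglyMeasurable
        (fun x => (fderiv ℝ f (c x y)).comp (consZeroCLM n)) logisticMeasure := by
      intro y
      have h1 : Measurable fun x => fderiv ℝ f (c x y) := (measurable_fderiv ℝ f).comp (hcx y)
      exact ((ContinuousLinearMap.compL ℝ (Fin n → ℝ) (Fin (n + 1) → ℝ) ℝ).flip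
        (consZeroCLM n)).continuous.comp_aestronglyMeasurable h1.aestronglyMeasurable
    have hDi : ∀ y, Integrable
        (fun x => (fderiv ℝ f (c x y)).comp (consZeroCLM n)) logisticMeasure := fun y =>
      Integrable.of_bound (hDm y) _ (ae_of_all _ fun x => hDbound x y)
    have hFder : ∀ y, HasFDerivAt F
        (∫ x, (fderiv ℝ f (c x y)).comp (consZeroCLM n) ∂logisticMeasure) y := by
      intro y
      refine hasFDerivAt_integral_of_dominated_of_fderiv_le
        (F' := fun y x => (fderiv ℝ f (c x y)).comp (consZeroCLM n))
        (bound := fun _ => K * ‖consZeroCLM n‖) Filter.univ_mem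
        (Filter.Eventually.of_forall fun y => (hfi y).aestronglyMeasurable) (hfi y) (hDm y)
        (ae_of_all _ fun x y _ => hDbound x y) (integrable_const _)
        (ae_of_all _ fun x y _ => ?_)
      exact (hf (c x y)).hasFDerivAt.comp y (hasFDerivAt_cons_right x y)
    have hF01 : ∀ y, F y ∈ Set.Icc (0 : ℝ) 1 := fun y =>
      ⟨integral_nonneg fun x => (h01 _).1, by
        simpa using integral_mono (hfi y) (integrable_const 1) fun x => (h01 (c x y)).2⟩
    have hFK : ∀ y, ‖fderiv ℝ F y‖ ≤ K * ‖consZeroCLM n‖ := by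
      intro y
      rw [(hFder y).fderiv]
      simpa using norm_integral_le_of_norm_le_const (μ := logisticMeasure)
        (ae_of_all _ fun x => hDbound x y)
    have hFd : Differentiable ℝ F := fun y => (hFder y).differentiableAt
    have hfprod : Integrable (fun p : ℝ × (Fin n → ℝ) => f (c p.1 p.2))
        (logisticMeasure.prod ν) :=
      Integrable.of_bound (hfm.comp hcm).aestronglyMeasurable 1 (ae_of_all _ fun x => by
        rw [Real.norm_of_nonneg (h01 _).1]; exact (h01 _).2)
    have hbprod : Integrable (fun p : ℝ × (Fin n → ℝ) => bobkovIntegrand f (c p.1 p.2))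
        (logisticMeasure.prod ν) :=
      (measurePreserving_cons n logisticMeasure).integrable_comp_of_integrable
        (integrable_bobkovIntegrand hf hK h01 _)
    have hmean : ∫ x, f x ∂(Measure.pi fun _ => logisticMeasure) = ∫ y, F y ∂ν := by
      rw [← (measurePreserving_cons n logisticMeasure).map_eq,
        integral_map hcm.aemeasurable hfm.aestronglyMeasurable]
      exact integral_prod_symm _ hfprod
    have henergy : ∫ x, bobkovIntegrand f x ∂(Measure.pi fun _ => logisticMeasure) =
        ∫ y, ∫ x, bobkovIntegrand f (c x y) ∂logisticMeasure ∂ν := by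
      rw [← (measurePreserving_cons n logisticMeasure).map_eq,
        integral_map hcm.aemeasurable (measurable_bobkovIntegrand hf).aestronglyMeasurable]
      exact integral_prod_symm _ hbprod
    rw [hmean, henergy]
    refine (ih hFd hFK hF01).trans (integral_mono (integrable_bobkovIntegrand hFd hFK hF01 ν)
      hbprod.integral_prod_right fun y => ?_)
    set u : ℝ → ℝ := fun x => √((f (c x y) * (1 - f (c x y)) / 4) ^ 2 +
      fderiv ℝ f (c x y) (Pi.single 0 1) ^ 2) with hu
    have hline : ∀ x, HasDerivAt (fun x => f (c x y)) (fderiv ℝ f (c x y) (Pi.single 0 1)) x :=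
      fun x => (hf (c x y)).hasFDerivAt.comp_hasDerivAt x (hasDerivAt_cons_left x y)
    have hpartial : ∀ i x, |fderiv ℝ f x (Pi.single i 1)| ≤ K := by
      intro i x
      refine ((fderiv ℝ f x).le_opNorm _).trans ?_
      simpa [Pi.norm_single] using hK x
    have hone : F y * (1 - F y) / 4 ≤ ∫ x, u x ∂logisticMeasure := by
      have h := logisticMeasure_functional_ineq (f := fun x => f (c x y)) (K := K)
        (fun x => (hline x).differentiableAt)
        (fun x => by rw [(hline x).deriv]; exact hpartial 0 _) (fun x => h01 _)
      refine h.trans_eq (integral_congr_ae (ae_of_all _ fun x => ?_))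
      simp only [(hline x).deriv, hu]
    have hdm : ∀ i, Measurable fun x => fderiv ℝ f (c x y) (Pi.single i 1) := fun i =>
      (measurable_fderiv_apply_const ℝ f _).comp (hcx y)
    have hpi : ∀ i, Integrable (fun x => fderiv ℝ f (c x y) (Pi.single i 1)) logisticMeasure :=
      fun i => Integrable.of_bound (hdm i).aestronglyMeasurable K
        (ae_of_all _ fun x => hpartial i _)
    have hum : Measurable u := by
      have := hfm.comp (hcx y)
      have := hdm 0
      simp only [hu]
      fun_prop
    have hui : Integrable u logisticMeasure := by
      refine Integrable.of_bound hum.aestronglyMeasurable (√(1 + K ^ 2)) (ae_of_all _ fun x => ?_)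
      rw [Real.norm_of_nonneg (Real.sqrt_nonneg _)]
      refine Real.sqrt_le_sqrt (add_le_add ?_ ?_)
      · have := h01 (c x y)
        refine pow_le_one₀ ?_ ?_ <;> nlinarith [this.1, this.2]
      · rw [← sq_abs (fderiv ℝ f _ _)]
        exact pow_le_pow_left₀ (abs_nonneg _) (hpartial 0 _) 2
    have hFpartial : ∀ i, fderiv ℝ F y (Pi.single i 1) =
        ∫ x, fderiv ℝ f (c x y) (Pi.single i.succ 1) ∂logisticMeasure := by
      intro i
      rw [(hFder y).fderiv, ContinuousLinearMap.integral_apply (hDi y)]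
      simp [consZeroCLM_single]
    have hmink := sqrt_sum_sq_integral_le (μ := logisticMeasure)
      (g := Fin.cons u fun (i : Fin n) x => fderiv ℝ f (c x y) (Pi.single i.succ 1))
      (fun i => by refine Fin.cases ?_ (fun i => ?_) i <;> simp [hui, hpi])
    simp only [Fin.sum_univ_succ, Fin.cons_zero, Fin.cons_succ] at hmink
    have hFu : √((F y * (1 - F y) / 4) ^ 2 + ∑ i, fderiv ℝ F y (Pi.single i 1) ^ 2) ≤
        √((∫ x, u x ∂logisticMeasure) ^ 2 +
          ∑ i : Fin n, (∫ x, fderiv ℝ f (c x y) (Pi.single i.succ 1) ∂logisticMeasure) ^ 2) := by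
      refine Real.sqrt_le_sqrt (add_le_add ?_ (Finset.sum_le_sum fun i _ => ?_))
      · refine pow_le_pow_left₀ ?_ hone 2
        have := hF01 y
        nlinarith [this.1, this.2, mul_nonneg this.1 (sub_nonneg.2 this.2)]
      · rw [hFpartial]
    refine (hFu.trans hmink).trans_eq (integral_congr_ae (ae_of_all _ fun x => ?_))
    simp only [bobkovIntegrand, hu, Fin.sum_univ_succ]
    rw [Real.sq_sqrt (by positivity), add_assoc]

lemma pi_logisticMeasure_eq_withDensity (N : ℕ) :
    (Measure.pi fun _ : Fin N => logisticMeasure) =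
      volume.withDensity fun x : Fin N → ℝ => ENNReal.ofReal (∏ i, logisticDensity (x i)) := by
  refine Measure.pi_eq fun s hs => ?_
  have hi : ∀ i, Integrable logisticDensity (volume.restrict (s i)) := fun i =>
    integrable_logisticDensity.integrableOn
  rw [withDensity_apply _ (MeasurableSet.univ_pi hs), volume_pi, Measure.restrict_pi_pi,
    ← ofReal_integral_eq_lintegral_ofReal (Integrable.fintype_prod hi)
      (ae_of_all _ fun x => Finset.prod_nonneg fun i _ => logisticDensity_nonneg _),
    integral_fintype_prod_eq_prod (fun _ => logisticDensity),
    ENNReal.ofReal_prod_of_nonneg fun i _ => integral_nonneg fun x => logisticDensity_nonneg x]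
  refine Finset.prod_congr rfl fun i _ => ?_
  rw [logisticMeasure, withDensity_apply _ (hs i),
    ← ofReal_integral_eq_lintegral_ofReal (hi i) (ae_of_all _ logisticDensity_nonneg)]

lemma measurePreserving_toLp_logisticProd (N : ℕ) :
    MeasurePreserving (WithLp.toLp 2) (Measure.pi fun _ : Fin N => logisticMeasure)
      (logisticProd N) := by
  have hm : Measurable fun x : EuclideanSpace ℝ (Fin N) =>
      ENNReal.ofReal (∏ i, logisticDensity (x i)) := by
    refine (Continuous.measurable ?_).ennreal_ofReal
    exact continuous_finsetProd _ fun i _ => continuous_logisticDensity.comp (by fun_prop)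
  refine ⟨(PiLp.volume_preserving_toLp (Fin N)).measurable, Measure.ext fun s hs => ?_⟩
  rw [Measure.map_apply (PiLp.volume_preserving_toLp (Fin N)).measurable hs,
    pi_logisticMeasure_eq_withDensity, logisticProd, withDensity_apply _ hs,
    withDensity_apply _ ((PiLp.volume_preserving_toLp (Fin N)).measurable hs)]
  exact (PiLp.volume_preserving_toLp (Fin N)).setLIntegral_comp_preimage hs hm

instance (N : ℕ) : IsProbabilityMeasure (logisticProd N) := by
  rw [← (measurePreserving_toLp_logisticProd N).map_eq]
  exact Measure.isProbabilityMeasure_map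
    (measurePreserving_toLp_logisticProd N).measurable.aemeasurable

lemma sum_sq_apply_single_le {N : ℕ} (L : EuclideanSpace ℝ (Fin N) →L[ℝ] ℝ) :
    ∑ i, L (EuclideanSpace.single i 1) ^ 2 ≤ ‖L‖ ^ 2 := by
  set v : EuclideanSpace ℝ (Fin N) := WithLp.toLp 2 fun i => L (EuclideanSpace.single i 1)
    with hv
  have hv2 : ‖v‖ ^ 2 = ∑ i, L (EuclideanSpace.single i 1) ^ 2 := by
    rw [EuclideanSpace.norm_sq_eq]
    simp [hv]
  have hLv : L v = ‖v‖ ^ 2 := by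
    have h : v = ∑ i, L (EuclideanSpace.single i 1) • EuclideanSpace.single i (1 : ℝ) := by
      ext j
      simp [hv, Pi.single_apply]
    rw [hv2]
    nth_rewrite 1 [h]
    simp [sq]
  rw [← hv2]
  rcases (norm_nonneg v).eq_or_lt with h0 | h0
  · rw [← h0, zero_pow two_ne_zero]
    exact sq_nonneg _
  · have h := (le_abs_self _).trans (L.le_opNorm v)
    rw [hLv, sq] at h
    exact pow_le_pow_left₀ h0.le (le_of_mul_le_mul_right h h0) 2

/-- Bobkov's inequality applied to a smooth function interpolating between `A` and `B`. -/
lemma mean_mul_le_measureReal_sdiff {N : ℕ} {f : EuclideanSpace ℝ (Fin N) → ℝ} {K : ℝ}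
    {A B : Set (EuclideanSpace ℝ (Fin N))} (hA : MeasurableSet A) (hB : MeasurableSet B)
    (hf : Differentiable ℝ f) (hK : ∀ x, ‖fderiv ℝ f x‖ ≤ K)
    (h01 : ∀ x, f x ∈ Set.Icc (0 : ℝ) 1) (hfA : ∀ x ∈ A, f x = 1) (hfB : ∀ x ∉ B, f x = 0) :
    (∫ x, f x ∂logisticProd N) * (1 - ∫ x, f x ∂logisticProd N) / 4 ≤
      (1 / 16 + K) * (logisticProd N).real (B \ A) := by
  have hmp := measurePreserving_toLp_logisticProd N
  set e : (Fin N → ℝ) →L[ℝ] EuclideanSpace ℝ (Fin N) :=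
    ((PiLp.continuousLinearEquiv 2 ℝ fun _ : Fin N => ℝ).symm :
      (Fin N → ℝ) →L[ℝ] EuclideanSpace ℝ (Fin N)) with he
  have hex : ∀ x, e x = WithLp.toLp 2 x := fun x => rfl
  have hder : ∀ x, HasFDerivAt (fun x => f (WithLp.toLp 2 x))
      ((fderiv ℝ f (WithLp.toLp 2 x)).comp e) x := fun x =>
    HasFDerivAt.comp (g := f) (f := e) x (hf _).hasFDerivAt e.hasFDerivAt
  have hK0 : 0 ≤ K := (norm_nonneg _).trans (hK 0)
  have h := pi_logisticMeasure_functional_ineq N (f := fun x => f (WithLp.toLp 2 x))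
    (K := K * ‖e‖) (fun x => (hder x).differentiableAt) (fun x => by
      rw [(hder x).fderiv]
      exact (ContinuousLinearMap.opNorm_comp_le _ _).trans
        (mul_le_mul_of_nonneg_right (hK _) (norm_nonneg _))) (fun x => h01 _)
  have hmean : ∫ x, f (WithLp.toLp 2 x) ∂(Measure.pi fun _ : Fin N => logisticMeasure) =
      ∫ x, f x ∂logisticProd N := by
    rw [← hmp.map_eq, integral_map hmp.measurable.aemeasurable
      hf.continuous.measurable.aestronglyMeasurable]
  rw [hmean] at h
  have hS : MeasurableSet (WithLp.toLp 2 ⁻¹' (B \ A) : Set (Fin N → ℝ)) :=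
    hmp.measurable (hB.diff hA)
  have hbound : ∀ x, bobkovIntegrand (fun x => f (WithLp.toLp 2 x)) x ≤
      (WithLp.toLp 2 ⁻¹' (B \ A) : Set (Fin N → ℝ)).indicator (fun _ => 1 / 16 + K) x := by
    intro x
    have hgrad : ∑ i, fderiv ℝ (fun x => f (WithLp.toLp 2 x)) x (Pi.single i 1) ^ 2 ≤
        ‖fderiv ℝ f (WithLp.toLp 2 x)‖ ^ 2 := by
      rw [(hder x).fderiv]
      exact sum_sq_apply_single_le _
    have hJ0 : 0 ≤ f (WithLp.toLp 2 x) * (1 - f (WithLp.toLp 2 x)) / 4 := by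
      have := h01 (WithLp.toLp 2 x)
      nlinarith [mul_nonneg this.1 (sub_nonneg.2 this.2)]
    by_cases hx : x ∈ (WithLp.toLp 2 ⁻¹' (B \ A) : Set (Fin N → ℝ))
    · rw [Set.indicator_of_mem hx]
      refine Real.sqrt_le_iff.2 ⟨by positivity, ?_⟩
      have hJ1 : f (WithLp.toLp 2 x) * (1 - f (WithLp.toLp 2 x)) / 4 ≤ 1 / 16 := by
        nlinarith [sq_nonneg (f (WithLp.toLp 2 x) - 1 / 2)]
      have h1 := pow_le_pow_left₀ (norm_nonneg _) (hK (WithLp.toLp 2 x)) 2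
      have h2 := pow_le_pow_left₀ hJ0 hJ1 2
      nlinarith
    · rw [Set.indicator_of_notMem hx]
      refine (Real.sqrt_eq_zero'.2 ?_).le
      have hcrit : fderiv ℝ f (WithLp.toLp 2 x) = 0 ∧
          f (WithLp.toLp 2 x) * (1 - f (WithLp.toLp 2 x)) = 0 := by
        by_cases hxA : WithLp.toLp 2 x ∈ A
        · refine ⟨IsLocalMax.fderiv_eq_zero (Filter.Eventually.of_forall fun y => ?_), ?_⟩
          · rw [hfA _ hxA]; exact (h01 y).2
          · rw [hfA _ hxA]; ring
        · have hxB : WithLp.toLp 2 x ∉ B := fun hxB => hx ⟨hxB, hxA⟩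
          refine ⟨IsLocalMin.fderiv_eq_zero (Filter.Eventually.of_forall fun y => ?_), ?_⟩
          · rw [hfB _ hxB]; exact (h01 y).1
          · rw [hfB _ hxB]; ring
      rw [hcrit.1, norm_zero] at hgrad
      rw [hcrit.2]
      linarith
  refine h.trans ((integral_mono_of_nonneg
    (ae_of_all _ fun x => bobkovIntegrand_nonneg _ x)
    ((integrable_const _).indicator hS) (ae_of_all _ hbound)).trans_eq ?_)
  rw [integral_indicator_const _ hS, smul_eq_mul, mul_comm, measureReal_def, measureReal_def,
    hmp.measure_preimage (hB.diff hA).nullMeasurableSet]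

/-- A smoothed version of the thickened indicator. -/
lemma exists_differentiable_cutoff {E : Type*} [NormedAddCommGroup E] [NormedSpace ℝ E]
    [FiniteDimensional ℝ E] [MeasurableSpace E] [BorelSpace E] (A : Set E) {h ε : ℝ}
    (hε : 0 < ε) (hεh : 2 * ε < h) :
    ∃ f : E → ℝ, Differentiable ℝ f ∧ (∀ x, ‖fderiv ℝ f x‖ ≤ 1 / (h - 2 * ε)) ∧
      (∀ x, f x ∈ Set.Icc (0 : ℝ) 1) ∧ (∀ x ∈ A, f x = 1) ∧
      ∀ x ∉ Metric.cthickening h A, f x = 0 := by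
  have hδ : 0 < h - 2 * ε := by linarith
  set g : E → ℝ := fun x => thickenedIndicator hδ (Metric.cthickening ε A) x with hg
  have hgl : LipschitzWith (h - 2 * ε).toNNReal⁻¹ g := fun x y =>
    lipschitzWith_thickenedIndicator hδ (Metric.cthickening ε A) x y
  have hg01 : ∀ x, g x ∈ Set.Icc (0 : ℝ) 1 := fun x =>
    ⟨NNReal.coe_nonneg _, NNReal.coe_le_one.2 (thickenedIndicator_le_one hδ _ x)⟩
  set μ : Measure E := Measure.addHaar with hμ
  set ν : Measure E := ProbabilityTheory.cond μ (Metric.ball 0 ε) with hν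
  have : IsProbabilityMeasure ν := ProbabilityTheory.cond_isProbabilityMeasure_of_finite
    (Metric.measure_ball_pos μ 0 hε).ne' measure_ball_lt_top.ne
  have hball : ∀ᵐ z ∂ν, ‖z‖ < ε := by
    filter_upwards [ProbabilityTheory.ae_cond_mem measurableSet_ball] with z hz
    simpa using hz
  have hgi : ∀ x, Integrable (fun z => g (x + z)) ν := fun x =>
    Integrable.of_bound
      (hgl.continuous.comp (continuous_const.add continuous_id)).measurable.aestronglyMeasurable 1
      (ae_of_all _ fun z => by rw [Real.norm_of_nonneg (hg01 _).1]; exact (hg01 _).2)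
  have hlip : LipschitzWith (h - 2 * ε).toNNReal⁻¹ fun x => ∫ z, g (x + z) ∂ν := by
    refine LipschitzWith.of_dist_le_mul fun x y => ?_
    rw [Real.dist_eq, ← Real.norm_eq_abs, ← integral_sub (hgi x) (hgi y)]
    refine (norm_integral_le_of_norm_le_const (C := ↑(h - 2 * ε).toNNReal⁻¹ * dist x y)
      (ae_of_all _ fun z => ?_)).trans_eq (by simp)
    simpa [Real.dist_eq] using hgl.dist_le_mul (x + z) (y + z)
  refine ⟨fun x => ∫ z, g (x + z) ∂ν, fun x => ?_, fun x => ?_, fun x => ⟨?_, ?_⟩,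
    fun x hx => ?_, fun x hx => ?_⟩
  · refine (hasFDerivAt_integral_of_dominated_loc_of_lip (F := fun x z => g (x + z))
      (F' := fun z => fderiv ℝ g (x + z)) (s := Set.univ)
      (bound := fun _ => ((h - 2 * ε).toNNReal⁻¹ : NNReal)) Filter.univ_mem
      (Filter.Eventually.of_forall fun x => (hgi x).aestronglyMeasurable) (hgi x) ?_ ?_
      (integrable_const _) ?_).2.differentiableAt
    · exact ((measurable_fderiv ℝ g).comp (measurable_const_add x)).aestronglyMeasurable
    · refine ae_of_all _ fun z => LipschitzWith.lipschitzOnWith ?_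
      refine LipschitzWith.of_dist_le_mul fun y y' => ?_
      simpa using hgl.dist_le_mul (y + z) (y' + z)
    · have h1 : ∀ᵐ z ∂μ, DifferentiableAt ℝ g (x + z) :=
        (measurePreserving_add_left μ x).quasiMeasurePreserving.ae hgl.ae_differentiableAt
      filter_upwards [ProbabilityTheory.cond_absolutelyContinuous h1] with z hz
      exact (hasFDerivAt_comp_add_right z).2 hz.hasFDerivAt
  · refine (norm_fderiv_le_of_lipschitz ℝ hlip).trans_eq ?_
    simp [hδ.le]
  · exact integral_nonneg fun z => (hg01 _).1
  · simpa using integral_mono (hgi x) (integrable_const 1) fun z => (hg01 (x + z)).2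
  · have h1 : ∀ᵐ z ∂ν, g (x + z) = 1 := by
      filter_upwards [hball] with z hz
      have : x + z ∈ Metric.cthickening ε A :=
        Metric.mem_cthickening_of_dist_le _ x ε A hx (by simpa using hz.le)
      simp only [hg, thickenedIndicator_one hδ _ this, NNReal.coe_one]
    simp [integral_congr_ae h1]
  · have h1 : ∀ᵐ z ∂ν, g (x + z) = 0 := by
      filter_upwards [hball] with z hz
      have : x + z ∉ Metric.thickening (h - 2 * ε) (Metric.cthickening ε A) := by
        intro hxz
        have h2 := Metric.thickening_cthickening_subset (h - 2 * ε) hε.le A hxz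
        obtain ⟨a, ha, hd⟩ := Metric.mem_thickening_iff.1 h2
        refine hx (Metric.mem_cthickening_of_dist_le x a h A ha ?_)
        have h3 : dist x (x + z) < ε := by simpa using hz
        linarith [dist_triangle x (x + z) a]
      simp only [hg, thickenedIndicator_zero hδ _ this, NNReal.coe_zero]
    simp [integral_congr_ae h1]

lemma isoC_le_half : isoC ≤ 1 / 2 := by
  refine Real.sSup_le ?_ (by norm_num)
  rintro _ ⟨u, hu, rfl⟩
  have hu' : 0 ≤ u := hu
  set s := √u with hs
  have hs0 : 0 ≤ s := Real.sqrt_nonneg u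
  have hsu : u = s ^ 2 := (Real.sq_sqrt hu').symm
  have key : 1 - Real.exp (-2 * u) ≤ s := by
    rcases le_total s (1 / 2) with h | h
    · have := Real.add_one_le_exp (-2 * u)
      nlinarith
    rcases le_total s 1 with h1 | h1
    · have h2 := Real.add_one_le_exp (1 - 2 * u)
      have h3 : Real.exp (1 - 2 * u) = Real.exp 1 * Real.exp (-2 * u) := by
        rw [← Real.exp_add]; ring_nf
      have h4 := Real.exp_one_lt_d9
      have h5 := Real.exp_pos (-2 * u)
      have h6 : 2 * (1 - s ^ 2) ≤ 3 * Real.exp (-2 * u) := by nlinarith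
      nlinarith
    · linarith [Real.exp_pos (-2 * u)]
  rcases hs0.eq_or_lt with h | h
  · simp only [← hs, ← h]; norm_num
  · simp only [← hs]
    rw [div_le_iff₀ (by positivity)]
    linarith

lemma mul_one_sub_le_measureReal_cthickening {N : ℕ} {A : Set (EuclideanSpace ℝ (Fin N))}
    (hA : MeasurableSet A) {h : ℝ} (h0 : 0 < h) (h1 : h < 1) :
    (logisticProd N).real A * (1 - (logisticProd N).real A) / 4 ≤
      (5 / 16 + 1 / (h - h ^ 2)) *
        ((logisticProd N).real (Metric.cthickening h A) - (logisticProd N).real A) := by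
  set μ := logisticProd N with hμ
  set B := Metric.cthickening h A with hBdef
  have hB : MeasurableSet B := Metric.isClosed_cthickening.measurableSet
  have hAB : A ⊆ B := Metric.self_subset_cthickening A
  obtain ⟨f, hf, hK, h01, hfA, hfB⟩ := exists_differentiable_cutoff A
    (h := h) (ε := h ^ 2 / 2) (by positivity) (by nlinarith)
  have hfi : Integrable f μ :=
    Integrable.of_bound hf.continuous.measurable.aestronglyMeasurable 1 (ae_of_all _ fun x => by
      rw [Real.norm_of_nonneg (h01 _).1]; exact (h01 _).2)
  have hmain := mean_mul_le_measureReal_sdiff hA hB hf hK h01 hfA hfB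
  rw [measureReal_sdiff hAB hA, mul_div_cancel₀ _ two_ne_zero, ← hμ] at hmain
  have hlo : μ.real A ≤ ∫ x, f x ∂μ := by
    rw [← integral_indicator_one hA]
    refine integral_mono ((integrable_const 1).indicator hA) hfi fun x => ?_
    refine Set.indicator_apply_le' (fun hx => (hfA x hx).ge) fun _ => (h01 x).1
  have hup : ∫ x, f x ∂μ ≤ μ.real B := by
    rw [← integral_indicator_one hB]
    refine integral_mono hfi ((integrable_const 1).indicator hB) fun x => ?_
    refine Set.le_indicator_apply (fun _ => (h01 x).2) fun hx => (hfB x hx).le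
  have hm1 : ∫ x, f x ∂μ ≤ 1 := hup.trans measureReal_le_one
  have hp0 : 0 ≤ μ.real A := measureReal_nonneg
  nlinarith [mul_nonneg (sub_nonneg.2 hlo)
    (by linarith : 0 ≤ 2 - (∫ x, f x ∂μ) - μ.real A)]

lemma ofReal_le_boundaryMeasure {N : ℕ} {A : Set (EuclideanSpace ℝ (Fin N))}
    (hA : MeasurableSet A) :
    ENNReal.ofReal ((logisticProd N).real A * (1 - (logisticProd N).real A) / 4) ≤
      boundaryMeasure (logisticProd N) A := by
  set μ := logisticProd N with hμ
  set I := μ.real A * (1 - μ.real A) / 4 with hI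
  have hlim : Filter.Tendsto (fun h : ℝ => ENNReal.ofReal (I / (5 / 16 * h + 1 / (1 - h))))
      (nhdsWithin 0 (Set.Ioi 0)) (nhds (ENNReal.ofReal I)) := by
    have hc : ContinuousAt (fun h : ℝ => I / (5 / 16 * h + 1 / (1 - h))) 0 := by
      refine ContinuousAt.div (by fun_prop) (ContinuousAt.add (by fun_prop)
        (ContinuousAt.div (by fun_prop) (by fun_prop) (by norm_num))) (by norm_num)
    have h1 : Filter.Tendsto (fun h : ℝ => I / (5 / 16 * h + 1 / (1 - h))) (nhds 0) (nhds I) := by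
      simpa using hc.tendsto
    exact (ENNReal.tendsto_ofReal h1).mono_left nhdsWithin_le_nhds
  rw [← hlim.liminf_eq, boundaryMeasure]
  refine Filter.liminf_le_liminf ?_
  filter_upwards [Ioo_mem_nhdsGT (zero_lt_one (α := ℝ))] with h hh
  have hmain := mul_one_sub_le_measureReal_cthickening hA hh.1 hh.2
  rw [← hμ, ← hI] at hmain
  have hden : 0 < 1 - h := by linarith [hh.2]
  have h0 := hh.1
  rw [← ofReal_measureReal, ← ofReal_measureReal, ← ENNReal.ofReal_sub _ measureReal_nonneg,
    ← ENNReal.ofReal_div_of_pos h0]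
  refine ENNReal.ofReal_le_ofReal ?_
  rw [div_le_div_iff₀ (by positivity) h0]
  refine (mul_le_mul_of_nonneg_right hmain h0.le).trans_eq ?_
  rw [show h - h ^ 2 = h * (1 - h) by ring]
  field_simp

/-- Dimension-free isoperimetric inequality for the logistic measure: for every `N ≥ 1`
and `t ∈ [0,1]` one has `I_{Λ^N}(t) ≥ (c₀/2) · t(1-t) = (c₀/2) I_Λ(t)`. -/
theorem logistic_dimension_free_isoperimetry
    (N : ℕ) (hN : 1 ≤ N) (t : ℝ) (ht : t ∈ Set.Icc (0 : ℝ) 1) :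
    ENNReal.ofReal (isoC / 2 * (t * (1 - t))) ≤ isopFun (logisticProd N) t := by
  refine le_sInf ?_
  rintro _ ⟨A, hA, rfl, rfl⟩
  refine le_trans (ENNReal.ofReal_le_ofReal ?_) (ofReal_le_boundaryMeasure hA)
  have h := mul_le_mul_of_nonneg_right isoC_le_half (mul_nonneg ht.1 (sub_nonneg.2 ht.2))
  rw [measureReal_def]
  linarith
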